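/- arXiv:1411.2049 — 5 statements merged into one kernel-verified Lean document; each statement's English description precedes it below -/
import Mathlib

section
/- Let T = (τ_ij) be an antisymmetric 4×4 complex matrix (τ_ji = −τ_ij, τ_ii = 0), let conj(T) denote its entrywise complex conjugate, and set R(τ) := τ₁₂τ₃₄ − τ₁₃τ₂₄ + τ₁₄τ₂₃ (the Pfaffian of T). Then det(I₄ + T·conj(T)) = (1 − Σ_{1≤i<j≤4} |τ_ij|² + |R(τ)|²)². -/
/-!
STATEMENT 13: for an antisymmetric 4×4 complex matrix T with Pfaffian
R(τ) = τ₁₂τ₃₄ − τ₁₃τ₂₄ + τ₁₄τ₂₃,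
det(I₄ + T·conj(T)) = (1 − Σ_{i<j} |τ_ij|² + |R(τ)|²)².
-/

/-- Laplace expansion of a `4 × 4` determinant along its first two rows. -/
theorem Matrix.det_fin_four_eq_laplace {R : Type*} [CommRing R] (M : Matrix (Fin 4) (Fin 4) R) :
    M.det =
        (M 0 0 * M 1 1 - M 0 1 * M 1 0) * (M 2 2 * M 3 3 - M 2 3 * M 3 2) -
        (M 0 0 * M 1 2 - M 0 2 * M 1 0) * (M 2 1 * M 3 3 - M 2 3 * M 3 1) +
        (M 0 0 * M 1 3 - M 0 3 * M 1 0) * (M 2 1 * M 3 2 - M 2 2 * M 3 1) +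
        (M 0 1 * M 1 2 - M 0 2 * M 1 1) * (M 2 0 * M 3 3 - M 2 3 * M 3 0) -
        (M 0 1 * M 1 3 - M 0 3 * M 1 1) * (M 2 0 * M 3 2 - M 2 2 * M 3 0) +
        (M 0 2 * M 1 3 - M 0 3 * M 1 2) * (M 2 0 * M 3 1 - M 2 1 * M 3 0) := by
  simp [Matrix.det_succ_row_zero, Fin.sum_univ_succ, Fin.succAbove]
  ring

/-- For alternating `4 × 4` matrices `A`, `B`, the determinant of `1 + A * B` is the square of a
polynomial in the entries which involves the Pfaffians of `A` and `B`. -/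
theorem Matrix.det_one_add_mul_of_alternating_fin_four {R : Type*} [CommRing R]
    (a b c d e f a' b' c' d' e' f' : R) :
    (1 + !![0, a, b, c; -a, 0, d, e; -b, -d, 0, f; -c, -e, -f, 0] *
        !![0, a', b', c'; -a', 0, d', e'; -b', -d', 0, f'; -c', -e', -f', 0]).det =
      (1 - a * a' - b * b' - c * c' - d * d' - e * e' - f * f' +
        (a * f - b * e + c * d) * (a' * f' - b' * e' + c' * d')) ^ 2 := by
  rw [Matrix.det_fin_four_eq_laplace]
  simp only [Matrix.add_apply, Matrix.mul_apply, Fin.sum_univ_four, Matrix.one_apply]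
  simp
  ring

theorem det_one_add_antisym_mul_conj_four
    (T : Matrix (Fin 4) (Fin 4) ℂ)
    (hanti : ∀ i j, T j i = - T i j) (hdiag : ∀ i, T i i = 0) :
    (1 + T * T.map (starRingEnd ℂ)).det =
      ((1 : ℂ)
        - (Complex.normSq (T 0 1) : ℂ) - (Complex.normSq (T 0 2) : ℂ)
        - (Complex.normSq (T 0 3) : ℂ) - (Complex.normSq (T 1 2) : ℂ)
        - (Complex.normSq (T 1 3) : ℂ) - (Complex.normSq (T 2 3) : ℂ)
        + (Complex.normSq (T 0 1 * T 2 3 - T 0 2 * T 1 3 + T 0 3 * T 1 2) : ℂ)) ^ 2 := by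
  have hT : T = !![0, T 0 1, T 0 2, T 0 3; -T 0 1, 0, T 1 2, T 1 3;
      -T 0 2, -T 1 2, 0, T 2 3; -T 0 3, -T 1 3, -T 2 3, 0] := by
    ext i j
    fin_cases i <;> fin_cases j <;> simp [hdiag, ← hanti]
  have hT' : T.map (starRingEnd ℂ) = !![0, star (T 0 1), star (T 0 2), star (T 0 3);
      -star (T 0 1), 0, star (T 1 2), star (T 1 3);
      -star (T 0 2), -star (T 1 2), 0, star (T 2 3);
      -star (T 0 3), -star (T 1 3), -star (T 2 3), 0] := by
    conv_lhs => rw [hT]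
    ext i j
    fin_cases i <;> fin_cases j <;> simp
  rw [hT']
  conv_lhs => enter [1, 2, 1]; rw [hT]
  rw [Matrix.det_one_add_mul_of_alternating_fin_four]
  simp only [← Complex.mul_conj, map_add, map_sub, map_mul, starRingEnd_apply]
end

section
/- Let n ≥ 1 and let T = (τ_ij) be an antisymmetric n×n complex matrix (τ_ji = −τ_ij, τ_ii = 0) whose entries satisfy all Plücker relations: τ_ij·τ_kl − τ_ik·τ_jl + τ_il·τ_jk = 0 for all 1 ≤ i < j < k < l ≤ n. Then det(Iₙ + T·conj(T)) = (1 − Σ_{1≤i<j≤n} |τ_ij|²)², where conj(T) is the entrywise complex conjugate. (In particular this holds for τ_ij = [z_i|z_j⟩ built from spinors z₁,…,zₙ ∈ ℂ², which always satisfy the Plücker relations.) -/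
/-- The Plücker relations on increasing quadruples of indices imply them on all quadruples. -/
theorem plucker_of_increasing {ι R : Type*} [LinearOrder ι] [CommRing R] (T : Matrix ι ι R)
    (hanti : ∀ i j, T j i = - T i j) (hdiag : ∀ i, T i i = 0)
    (hplucker : ∀ i j k l : ι, i < j → j < k → k < l →
      T i j * T k l - T i k * T j l + T i l * T j k = 0) (i j k l : ι) :
    T i j * T k l - T i k * T j l + T i l * T j k = 0 := by
  have swap₁₂ : ∀ i j k l : ι, T i j * T k l - T i k * T j l + T i l * T j k = 0 →
      T j i * T k l - T j k * T i l + T j l * T i k = 0 := fun i j k l h => by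
    rw [hanti i j]; linear_combination -h
  have swap₂₃ : ∀ i j k l : ι, T i j * T k l - T i k * T j l + T i l * T j k = 0 →
      T i k * T j l - T i j * T k l + T i l * T k j = 0 := fun i j k l h => by
    rw [hanti j k]; linear_combination -h
  have swap₃₄ : ∀ i j k l : ι, T i j * T k l - T i k * T j l + T i l * T j k = 0 →
      T i j * T l k - T i l * T j k + T i k * T j l = 0 := fun i j k l h => by
    rw [hanti k l]; linear_combination -h
  have eq₁₂ : ∀ i k l : ι, T i i * T k l - T i k * T i l + T i l * T i k = 0 := fun i k l => by
    rw [hdiag]; ring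
  have eq₂₃ : ∀ i j l : ι, T i j * T j l - T i j * T j l + T i l * T j j = 0 := fun i j l => by
    rw [hdiag]; ring
  have eq₃₄ : ∀ i j k : ι, T i j * T k k - T i k * T j k + T i k * T j k = 0 := fun i j k => by
    rw [hdiag]; ring
  have sorted_tail : ∀ i j k l : ι, j < k → k < l →
      T i j * T k l - T i k * T j l + T i l * T j k = 0 := by
    intro i j k l hjk hkl
    rcases lt_trichotomy i j with h | rfl | hj
    · exact hplucker _ _ _ _ h hjk hkl
    · exact eq₁₂ _ _ _
    apply swap₁₂
    rcases lt_trichotomy i k with h | rfl | hk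
    · exact hplucker _ _ _ _ hj h hkl
    · exact eq₂₃ _ _ _
    apply swap₂₃
    rcases lt_trichotomy i l with h | rfl | hl
    · exact hplucker _ _ _ _ hjk hk h
    · exact eq₃₄ _ _ _
    exact swap₃₄ _ _ _ _ (hplucker _ _ _ _ hjk hkl hl)
  have sorted_last : ∀ i j k l : ι, k < l →
      T i j * T k l - T i k * T j l + T i l * T j k = 0 := by
    intro i j k l hkl
    rcases lt_trichotomy j k with h | rfl | hk
    · exact sorted_tail _ _ _ _ h hkl
    · exact eq₂₃ _ _ _
    apply swap₂₃
    rcases lt_trichotomy j l with h | rfl | hl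
    · exact sorted_tail _ _ _ _ hk h
    · exact eq₃₄ _ _ _
    exact swap₃₄ _ _ _ _ (sorted_tail _ _ _ _ hkl hl)
  rcases lt_trichotomy k l with h | rfl | h
  · exact sorted_last _ _ _ _ h
  · exact eq₃₄ _ _ _
  · exact swap₃₄ _ _ _ _ (sorted_last _ _ _ _ h)

/-- A symmetric double sum with zero diagonal is twice the sum over the pairs `i < j`. -/
theorem sum_sum_eq_two_mul_sum_lt {ι R : Type*} [Fintype ι] [LinearOrder ι] [CommRing R]
    (f : ι → ι → R) (hsymm : ∀ i j, f i j = f j i) (hdiag : ∀ i, f i i = 0) :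
    ∑ i, ∑ j, f i j = 2 * ∑ i, ∑ j ∈ Finset.univ.filter (fun j => i < j), f i j := by
  have hsplit : ∀ i j, f i j = (if i < j then f i j else 0) + (if j < i then f j i else 0) := by
    intro i j
    rcases lt_trichotomy i j with h | rfl | h
    · simp [h, h.not_gt]
    · simp [hdiag]
    · simp [h, h.not_gt, hsymm i j]
  simp_rw [Finset.sum_filter]
  rw [Finset.sum_congr rfl fun i _ => Finset.sum_congr rfl fun j _ => hsplit i j]
  simp_rw [Finset.sum_add_distrib]
  rw [Finset.sum_comm (f := fun i j => if j < i then f j i else 0), two_mul]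

/-- The bilinear form of an antisymmetric matrix is antisymmetric. -/
theorem dotProduct_mulVec_skew {ι R : Type*} [Fintype ι] [CommRing R]
    (S : Matrix ι ι R) (hS : S.transpose = -S) (x y : ι → R) :
    x ⬝ᵥ S.mulVec y = -(y ⬝ᵥ S.mulVec x) := by
  rw [Matrix.dotProduct_mulVec, ← Matrix.mulVec_transpose, hS, Matrix.neg_mulVec,
    neg_dotProduct, dotProduct_comm]

/-- For `S` alternating, `det (1 + (u vᵀ - v uᵀ) S) = (1 + vᵀ S u)²`. -/
theorem det_one_add_wedge_mul_antisym {ι R : Type*} [Fintype ι] [DecidableEq ι] [CommRing R]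
    (u v : ι → R) (S : Matrix ι ι R) (hS : S.transpose = -S)
    (hself : ∀ w : ι → R, w ⬝ᵥ S.mulVec w = 0) :
    (1 + (Matrix.vecMulVec u v - Matrix.vecMulVec v u) * S).det =
      (1 + v ⬝ᵥ S.mulVec u) ^ 2 := by
  have hfactor : Matrix.vecMulVec u v - Matrix.vecMulVec v u =
      (Matrix.of ![u, v]).transpose * Matrix.of ![v, -u] := by
    ext i j
    simp [Matrix.mul_apply, Matrix.vecMulVec_apply, Fin.sum_univ_two, sub_eq_add_neg]
  have hskew := dotProduct_mulVec_skew S hS u v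
  have hentry : ∀ a b : Fin 2,
      (Matrix.of ![v, -u] * S * (Matrix.of ![u, v]).transpose) a b =
        (![v, -u] a) ⬝ᵥ S.mulVec (![u, v] b) := by
    intro a b
    rw [Matrix.mul_assoc]
    rfl
  rw [hfactor, Matrix.mul_assoc, Matrix.det_one_add_mul_comm, Matrix.det_fin_two]
  simp only [Matrix.add_apply, hentry]
  simp [hself, hskew]
  ring

/-!
STATEMENT 14: for an antisymmetric n×n complex matrix T all of whose 4×4
Pfaffian minors vanish (the Plücker relations),
det(Iₙ + T·conj(T)) = (1 − Σ_{i<j} |τ_ij|²)².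
-/

theorem det_one_add_antisym_mul_conj_plucker
    (n : ℕ) (hn : 1 ≤ n) (T : Matrix (Fin n) (Fin n) ℂ)
    (hanti : ∀ i j, T j i = - T i j) (hdiag : ∀ i, T i i = 0)
    (hplucker : ∀ i j k l : Fin n, i < j → j < k → k < l →
      T i j * T k l - T i k * T j l + T i l * T j k = 0) :
    (1 + T * T.map (starRingEnd ℂ)).det =
      ((1 : ℂ) - ∑ i : Fin n, ∑ j ∈ Finset.univ.filter (fun j => i < j),
        (Complex.normSq (T i j) : ℂ)) ^ 2 := by
  by_cases hT : T = 0
  · simp [hT]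
  obtain ⟨a, b, hab⟩ : ∃ a b, T a b ≠ 0 := by
    by_contra! h
    exact hT (Matrix.ext h)
  set u : Fin n → ℂ := fun k => T a k / T a b
  set v : Fin n → ℂ := T b
  set S := T.map (starRingEnd ℂ) with hSdef
  have hwedge : ∀ i j, T i j = u i * v j - v i * u j := by
    intro i j
    have h := plucker_of_increasing T hanti hdiag hplucker a b i j
    simp only [u, v]
    field_simp
    linear_combination h
  have hTeq : T = Matrix.vecMulVec u v - Matrix.vecMulVec v u := by
    ext i j
    simp [Matrix.vecMulVec_apply, hwedge i j]
  have hS : S.transpose = -S := by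
    ext i j
    simp [hSdef, hanti i j]
  have hdot : ∀ x y : Fin n → ℂ, x ⬝ᵥ S.mulVec y = ∑ i, ∑ j, x i * S i j * y j := by
    intro x y
    simp [dotProduct, Matrix.mulVec, Finset.mul_sum, mul_assoc]
  have hskew := dotProduct_mulVec_skew S hS
  have hsum : v ⬝ᵥ S.mulVec u = -∑ i : Fin n, ∑ j ∈ Finset.univ.filter (fun j => i < j),
      (Complex.normSq (T i j) : ℂ) := by
    have hdouble := sum_sum_eq_two_mul_sum_lt (fun i j => (Complex.normSq (T i j) : ℂ))
      (fun i j => by simp [hanti i j]) (fun i => by simp [hdiag])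
    have hexpand : ∑ i, ∑ j, (Complex.normSq (T i j) : ℂ) =
        u ⬝ᵥ S.mulVec v - v ⬝ᵥ S.mulVec u := by
      rw [hdot, hdot, ← Finset.sum_sub_distrib]
      refine Finset.sum_congr rfl fun i _ => ?_
      rw [← Finset.sum_sub_distrib]
      refine Finset.sum_congr rfl fun j _ => ?_
      rw [← Complex.mul_conj]
      change T i j * S i j = _
      rw [hwedge i j]
      ring
    linear_combination (1 / 2 : ℂ) * hskew u v + (1 / 2 : ℂ) * hexpand - (1 / 2 : ℂ) * hdouble
  have hself : ∀ w : Fin n → ℂ, w ⬝ᵥ S.mulVec w = 0 := fun w => by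
    linear_combination (1 / 2 : ℂ) * hskew w w
  rw [show T * S = (Matrix.vecMulVec u v - Matrix.vecMulVec v u) * S by rw [← hTeq],
    det_one_add_wedge_mul_antisym u v S hS hself, hsum, ← sub_eq_add_neg]
end

section
/- Let n ≥ 1 and let z₁,…,zₙ and w₁,…,wₙ be spinors in ℂ². Define the 4×4 complex matrix X in 2×2 blocks by X₁₁ = X₂₂ = 0, X₁₂ := Σ_{i=1}^n |z_i⟩[w_i|, and X₂₁ := −Σ_{i=1}^n |w_i⟩[z_i|. Then det(I₄ + X) = (1 + Σ_{1≤i<j≤n} [w_i|w_j⟩·[z_j|z_i⟩)². (This is the evaluation of the generating functional of coherent spin network amplitudes for the n-edge theta graph, whose expansion generates the scalar products of all n-valent coherent intertwiners.) -/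
/-!
STATEMENT 15: evaluation of the generating functional of coherent spin
network amplitudes for the n-edge theta graph:
det(I₄ + X) = (1 + Σ_{i<j} [w_i|w_j⟩·[z_j|z_i⟩)²
where X has 2×2 blocks X₁₂ = Σᵢ |z_i⟩[w_i|, X₂₁ = −Σᵢ |w_i⟩[z_i|.
-/

noncomputable section

abbrev Spinor := Fin 2 → ℂ

/-- The holomorphic bracket `[z|w⟩ = z₀w₁ − z₁w₀`. -/
def bra (z w : Spinor) : ℂ := z 0 * w 1 - z 1 * w 0

/-- The covector `[w| = (−w₁, w₀)` (no conjugation). -/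
def braRow (w : Spinor) : Fin 2 → ℂ := ![-(w 1), w 0]

/-- The 2×2 matrix `|z⟩[w|` with (A,B) entry `z_A·([w|)_B`. -/
def ketBra (z w : Spinor) : Matrix (Fin 2) (Fin 2) ℂ :=
  Matrix.of fun A B => z A * braRow w B

theorem Finset.sum_sum_eq_sum_sum_lt_add_swap {ι M : Type*} [Fintype ι] [LinearOrder ι]
    [AddCommMonoid M] (g : ι → ι → M) (hg : ∀ i, g i i = 0) :
    ∑ i, ∑ j, g i j = ∑ i, ∑ j ∈ Finset.univ.filter (fun j => i < j), (g i j + g j i) := by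
  have hsplit : ∀ i j, g i j = (if i < j then g i j else 0) + (if j < i then g i j else 0) := by
    intro i j
    rcases lt_trichotomy i j with h | rfl | h
    · simp [h, h.not_gt]
    · simp [hg]
    · simp [h, h.not_gt]
  simp only [Finset.sum_add_distrib, Finset.sum_filter]
  rw [Finset.sum_congr rfl fun i _ => Finset.sum_congr rfl fun j _ => hsplit i j]
  simp only [Finset.sum_add_distrib]
  congr 1
  exact Finset.sum_comm

theorem sum_bra_mul_bra_eq {ι : Type*} [Fintype ι] [LinearOrder ι] (z w : ι → Spinor) :
    ∑ i, ∑ j ∈ Finset.univ.filter (fun j => i < j), bra (w i) (w j) * bra (z j) (z i) =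
      (∑ i, z i 0 * w i 1) * (∑ i, z i 1 * w i 0) -
        (∑ i, z i 0 * w i 0) * (∑ i, z i 1 * w i 1) := by
  simp only [Finset.sum_mul_sum, ← Finset.sum_sub_distrib]
  rw [Finset.sum_sum_eq_sum_sum_lt_add_swap _ fun i => by ring]
  refine Finset.sum_congr rfl fun i _ => Finset.sum_congr rfl fun j _ => ?_
  simp only [bra]
  ring

theorem theta_graph_generating_functional
    (n : ℕ) (hn : 1 ≤ n) (z w : Fin n → Spinor) :
    (1 + Matrix.fromBlocks 0 (∑ i : Fin n, ketBra (z i) (w i))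
        (- ∑ i : Fin n, ketBra (w i) (z i)) 0).det =
      ((1 : ℂ) + ∑ i : Fin n, ∑ j ∈ Finset.univ.filter (fun j => i < j),
        bra (w i) (w j) * bra (z j) (z i)) ^ 2 := by
  rw [sum_bra_mul_bra_eq, ← Matrix.fromBlocks_one, Matrix.fromBlocks_add]
  simp only [zero_add, add_zero]
  rw [Matrix.det_fromBlocks_one₁₁]
  simp only [Matrix.det_fin_two, Matrix.sub_apply, Matrix.mul_apply, Fin.sum_univ_two,
    Matrix.neg_apply, Matrix.sum_apply, ketBra, braRow, Matrix.of_apply, Matrix.cons_val_zero,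
    Matrix.cons_val_one, mul_neg, neg_mul, Finset.sum_neg_distrib, Matrix.one_apply_eq,
    Matrix.one_apply_ne zero_ne_one, Matrix.one_apply_ne one_ne_zero, mul_comm (w _ _)]
  ring
end
end

section
/- Let n ≥ 1 and let T = (τ_ij) be an antisymmetric n×n complex matrix (τ_ji = −τ_ij, τ_ii = 0) of operator norm strictly less than 1 (equivalently, Iₙ − T·Tᴴ is positive definite). Then the function (z₁,…,zₙ) ↦ exp(2·Re Σ_{1≤i<j≤n} τ_ij·[z_i|z_j⟩) is integrable on (ℂ²)ⁿ against the product Gaussian measure ∏_i dμ(z_i), and ∫_{(ℂ²)ⁿ} exp(2·Re Σ_{i<j} τ_ij·[z_i|z_j⟩) ∏_{i=1}^n dμ(z_i) = 1 / det(Iₙ + T·conj(T)), where conj(T) is the entrywise conjugate of T (note Iₙ + T·conj(T) = Iₙ − T·Tᴴ). (This evaluates the scalar product of two Schwinger generating functionals of the discrete-coherent intertwiner basis.) -/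
/-!
STATEMENT 17: the scalar product of two Schwinger generating functionals:
∫ exp(2·Re Σ_{i<j} τ_ij·[z_i|z_j⟩) ∏ dμ(z_i) = 1/det(Iₙ + T·conj(T)).
-/

noncomputable section

open MeasureTheory
open scoped ComplexOrder

/-- Density of the Gaussian measure dμ(z) = π⁻²·e^(−⟨z|z⟩) dz on ℂ². -/
def gdens (z : Spinor) : ℝ :=
  Real.pi⁻¹ ^ 2 * Real.exp (-(Complex.normSq (z 0) + Complex.normSq (z 1)))

open Matrix

/-- The Gaussian integral over `ℂ^ι` of the standard Hermitian form. -/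
theorem integral_exp_neg_sum_normSq (ι : Type*) [Fintype ι] :
    ∫ v : ι → ℂ, Real.exp (-∑ i, Complex.normSq (v i)) = Real.pi ^ Fintype.card ι := by
  have one_dim : ∫ z : ℂ, Real.exp (-Complex.normSq z) = Real.pi := by
    have h := GaussianFourier.integral_rexp_neg_mul_sq_norm (V := ℂ) one_pos
    simpa [Complex.normSq_eq_norm_sq, Complex.finrank_real_complex] using h
  simp_rw [← Finset.sum_neg_distrib, Real.exp_sum]
  rw [integral_fintype_prod_volume_eq_pow (fun z : ℂ => Real.exp (-Complex.normSq z)), one_dim]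

/-- A complex matrix, viewed as a real-linear map, scales Lebesgue measure by `|det|²`. -/
theorem integral_comp_mulVec {ι : Type*} [Fintype ι] [DecidableEq ι] (B : Matrix ι ι ℂ)
    (hB : B.det ≠ 0) (f : (ι → ℂ) → ℝ) :
    ∫ v, f (B *ᵥ v) = (Complex.normSq B.det)⁻¹ * ∫ v, f v := by
  let L : (ι → ℂ) →ₗ[ℝ] (ι → ℂ) := (Matrix.toLin' B).restrictScalars ℝ
  have hL : LinearMap.det L = Complex.normSq B.det := by
    rw [LinearMap.det_restrictScalars, Algebra.norm_complex_apply, LinearMap.det_toLin']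
  have hL0 : LinearMap.det L ≠ 0 := by simpa [hL] using hB
  let e := (LinearEquiv.ofIsUnitDet (f := L) (v := Module.finBasis ℝ (ι → ℂ))
    (v' := Module.finBasis ℝ (ι → ℂ)) (by simpa using hL0)).toContinuousLinearEquiv
  have hmap := e.toHomeomorph.toMeasurableEquiv.measurableEmbedding.integral_map
    (μ := volume) f
  have hvol := Measure.map_linearMap_addHaar_eq_smul_addHaar volume hL0
  change ∫ y, f y ∂(Measure.map L volume) = ∫ v, f (B *ᵥ v) at hmap
  rw [← hmap, hvol, integral_smul_measure, hL, ENNReal.toReal_ofReal (abs_nonneg _),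
    abs_of_nonneg (inv_nonneg.2 (Complex.normSq_nonneg _)), smul_eq_mul]

/-- The Gaussian integral over `ℂ^ι` of a positive definite Hermitian form. -/
theorem Matrix.PosDef.integral_exp_neg_re_dotProduct_mulVec {ι : Type*} [Fintype ι] [DecidableEq ι]
    {M : Matrix ι ι ℂ} (hM : M.PosDef) :
    ∫ v : ι → ℂ, Real.exp (-(star v ⬝ᵥ M *ᵥ v).re)
      = Real.pi ^ Fintype.card ι / M.det.re := by
  obtain ⟨B, rfl⟩ : ∃ B : Matrix ι ι ℂ, M = Bᴴ * B := by
    open scoped MatrixOrder in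
    exact CStarAlgebra.nonneg_iff_eq_star_mul_self.mp hM.posSemidef.nonneg
  have hdet : (Bᴴ * B).det = (Complex.normSq B.det : ℂ) := by
    rw [det_mul, det_conjTranspose, Complex.star_def, ← Complex.normSq_eq_conj_mul_self]
  have hB : B.det ≠ 0 := by
    intro h
    have := hM.det_pos
    simp [hdet, h] at this
  have hform : ∀ v, (star v ⬝ᵥ (Bᴴ * B) *ᵥ v).re = ∑ i, Complex.normSq ((B *ᵥ v) i) := by
    intro v
    rw [← mulVec_mulVec, dotProduct_mulVec, ← star_mulVec, dotProduct, Complex.re_sum]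
    refine Finset.sum_congr rfl fun i _ => ?_
    rw [Pi.star_apply, Complex.star_def, ← Complex.normSq_eq_conj_mul_self, Complex.ofReal_re]
  simp_rw [hform, hdet, Complex.ofReal_re]
  rw [integral_comp_mulVec B hB (fun v => Real.exp (-∑ i, Complex.normSq (v i))),
    integral_exp_neg_sum_normSq, div_eq_inv_mul]

/-- If `1 - T Tᴴ` is positive definite, so is the Hermitian dilation `[[1, -T], [-Tᴴ, 1]]`. -/
theorem Matrix.PosDef.fromBlocks_one_neg {m n : Type*} [Fintype m] [Fintype n] [DecidableEq m]
    [DecidableEq n] {T : Matrix m n ℂ} (hT : (1 - T * Tᴴ).PosDef) :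
    (fromBlocks 1 (-T) (-T)ᴴ 1).PosDef := by
  have hpsd : (fromBlocks 1 (-T) (-T)ᴴ 1).PosSemidef := by
    let _ : Invertible (1 : Matrix n n ℂ) := invertibleOne
    rw [PosDef.fromBlocks₂₂ _ _ PosDef.one]
    simpa using hT.posSemidef
  rw [hpsd.posDef_iff_det_ne_zero, det_fromBlocks_one₂₂]
  simpa using hT.det_pos.ne'

/-- Splits a family of spinors into the conjugated family of first components and the family of
second components. -/
def spinorSplit (ι : Type*) : (ι → Spinor) ≃ᵐ (ι ⊕ ι → ℂ) :=
  ((MeasurableEquiv.arrowCongr' (Equiv.refl ι)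
      (MeasurableEquiv.finTwoArrow.trans
        (Complex.conjLIE.toHomeomorph.toMeasurableEquiv.prodCongr (MeasurableEquiv.refl ℂ)))).trans
    (MeasurableEquiv.arrowProdEquivProdArrow ℂ ℂ ι)).trans
    (MeasurableEquiv.sumPiEquivProdPi fun _ => ℂ).symm

theorem spinorSplit_apply {ι : Type*} (z : ι → Spinor) :
    spinorSplit ι z = Sum.elim (star fun i => z i 0) (fun i => z i 1) := by
  ext (i | i) <;> rfl

theorem volume_preserving_spinorSplit (ι : Type*) [Fintype ι] :
    MeasurePreserving (spinorSplit ι) := by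
  refine MeasurePreserving.trans (MeasurePreserving.trans (volume_preserving_arrowCongr' _ _ ?_)
    (volume_measurePreserving_arrowProdEquivProdArrow ℂ ℂ ι))
    (volume_measurePreserving_sumPiEquivProdPi_symm fun _ => ℂ)
  exact (volume_preserving_finTwoArrow ℂ).trans
    (Complex.conjLIE.measurePreserving.prod (MeasurePreserving.id volume))

/-- For antisymmetric `T`, the sum over pairs is a bilinear form in the spinor components. -/
theorem sum_lt_mul_bra {ι : Type*} [Fintype ι] [LinearOrder ι] {T : Matrix ι ι ℂ}
    (hanti : ∀ i j, T j i = -T i j) (z : ι → Spinor) :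
    ∑ i, ∑ j ∈ Finset.univ.filter (fun j => i < j), T i j * bra (z i) (z j)
      = (fun i => z i 0) ⬝ᵥ T *ᵥ (fun i => z i 1) := by
  have hsplit : ∀ i j, (if i < j then T i j * bra (z i) (z j) else 0)
      = (if i < j then z i 0 * (T i j * z j 1) else 0)
        + (if i < j then z j 0 * (T j i * z i 1) else 0) := by
    intro i j
    split_ifs
    · rw [hanti i j, bra]; ring
    · simp
  simp_rw [Finset.sum_filter, hsplit, Finset.sum_add_distrib]
  rw [Finset.sum_comm (f := fun i j => if i < j then z j 0 * (T j i * z i 1) else 0),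
    ← Finset.sum_add_distrib]
  simp_rw [dotProduct, mulVec, dotProduct, Finset.mul_sum, ← Finset.sum_add_distrib]
  refine Finset.sum_congr rfl fun i _ => Finset.sum_congr rfl fun j _ => ?_
  rcases lt_trichotomy i j with h | rfl | h
  · simp [h, h.not_gt]
  · simp [self_eq_neg.1 (hanti i i)]
  · simp [h, h.not_gt]

theorem re_star_dotProduct_fromBlocks_one_neg {m n : Type*} [Fintype m] [Fintype n]
    [DecidableEq m] [DecidableEq n] (T : Matrix m n ℂ) (x : m → ℂ) (y : n → ℂ) :
    (star (Sum.elim (star x) y) ⬝ᵥ fromBlocks 1 (-T) (-T)ᴴ 1 *ᵥ Sum.elim (star x) y).re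
      = ∑ i, Complex.normSq (x i) + ∑ j, Complex.normSq (y j) - 2 * (x ⬝ᵥ T *ᵥ y).re := by
  have hstar : star (Sum.elim (star x) y) = Sum.elim x (star y) := by
    ext (i | i) <;> simp
  have hx : x ⬝ᵥ star x = ((∑ i, Complex.normSq (x i) : ℝ) : ℂ) := by
    simp [dotProduct, Complex.mul_conj]
  have hy : star y ⬝ᵥ y = ((∑ i, Complex.normSq (y i) : ℝ) : ℂ) := by
    simp [dotProduct, Complex.normSq_eq_conj_mul_self]
  have hcross : star y ⬝ᵥ Tᴴ *ᵥ star x = star (x ⬝ᵥ T *ᵥ y) := by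
    rw [dotProduct_mulVec, ← star_mulVec, ← star_dotProduct_star, dotProduct_comm]
  rw [hstar, fromBlocks_mulVec, sumElim_dotProduct_sumElim]
  simp only [Sum.elim_comp_inl, Sum.elim_comp_inr, conjTranspose_neg, one_mulVec, neg_mulVec,
    dotProduct_add, dotProduct_neg, hx, hy, hcross, Complex.add_re, Complex.neg_re,
    Complex.ofReal_re, Complex.star_def, Complex.conj_re]
  ring

theorem schwinger_generating_functional_scalar_product
    (n : ℕ) (hn : 1 ≤ n) (T : Matrix (Fin n) (Fin n) ℂ)
    (hanti : ∀ i j, T j i = - T i j) (hdiag : ∀ i, T i i = 0)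
    (hpos : (1 - T * T.conjTranspose).PosDef) :
    Integrable (fun z : Fin n → Spinor =>
        Real.exp (2 * (∑ i : Fin n, ∑ j ∈ Finset.univ.filter (fun j => i < j),
            T i j * bra (z i) (z j)).re)
          * ∏ i, gdens (z i)) volume
    ∧ (∫ z : Fin n → Spinor,
        ((Real.exp (2 * (∑ i : Fin n, ∑ j ∈ Finset.univ.filter (fun j => i < j),
            T i j * bra (z i) (z j)).re)
          * ∏ i, gdens (z i) : ℝ) : ℂ))
      = 1 / (1 + T * T.map (starRingEnd ℂ)).det := by
  have hM := hpos.fromBlocks_one_neg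
  have hdet : (fromBlocks 1 (-T) (-T)ᴴ 1).det = (1 - T * Tᴴ).det := by
    simp [det_fromBlocks_one₂₂]
  have hconj : 1 + T * T.map (starRingEnd ℂ) = 1 - T * Tᴴ := by
    have : T.map (starRingEnd ℂ) = -Tᴴ := by
      ext i j
      simp [hanti i j]
    rw [this, Matrix.mul_neg, sub_eq_add_neg]
  obtain ⟨hre, him⟩ := Complex.pos_iff.1 hpos.det_pos
  have hdet_real : (1 - T * Tᴴ).det = ((1 - T * Tᴴ).det.re : ℂ) :=
    Complex.ext rfl (by simpa using him.symm)
  have hpoint : ∀ z : Fin n → Spinor,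
      Real.exp (2 * (∑ i : Fin n, ∑ j ∈ Finset.univ.filter (fun j => i < j),
            T i j * bra (z i) (z j)).re) * ∏ i, gdens (z i)
        = (Real.pi ^ Fintype.card (Fin n ⊕ Fin n))⁻¹ *
          Real.exp (-(star (spinorSplit (Fin n) z) ⬝ᵥ
            fromBlocks 1 (-T) (-T)ᴴ 1 *ᵥ spinorSplit (Fin n) z).re) := by
    intro z
    rw [sum_lt_mul_bra hanti, spinorSplit_apply, re_star_dotProduct_fromBlocks_one_neg]
    simp_rw [gdens, Finset.prod_mul_distrib, ← Real.exp_sum, Finset.sum_neg_distrib,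
      Finset.sum_add_distrib]
    rw [mul_left_comm, ← Real.exp_add, Finset.prod_const, Finset.card_univ, ← pow_mul,
      Fintype.card_sum, ← two_mul, inv_pow]
    congr 2
    ring
  have h_integral : ∫ z : Fin n → Spinor,
      Real.exp (2 * (∑ i : Fin n, ∑ j ∈ Finset.univ.filter (fun j => i < j),
            T i j * bra (z i) (z j)).re) * ∏ i, gdens (z i)
        = 1 / (1 - T * Tᴴ).det.re := by
    simp_rw [hpoint]
    rw [integral_const_mul, (volume_preserving_spinorSplit (Fin n)).integral_comp'
      (g := fun v => Real.exp (-(star v ⬝ᵥ fromBlocks 1 (-T) (-T)ᴴ 1 *ᵥ v).re)),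
      hM.integral_exp_neg_re_dotProduct_mulVec, hdet]
    field_simp
  refine ⟨.of_integral_ne_zero ?_, ?_⟩
  · rw [h_integral]
    exact (one_div_pos.2 hre).ne'
  · refine (integral_ofReal.trans (congrArg Complex.ofReal h_integral)).trans ?_
    rw [hconj, hdet_real]
    simp
end
end

section
/- For all natural numbers a, b, c, a', b', c' and all independent evaluation of the Bargmann inner product of trivalent intertwiner monomials: ∫_{(ℂ²)³} conj( [z₁|z₂⟩^a · [z₁|z₃⟩^b · [z₂|z₃⟩^c ) · [z₁|z₂⟩^{a'} · [z₁|z₃⟩^{b'} · [z₂|z₃⟩^{c'} ∏_{i=1}^3 dμ(z_i) = 0 unless (a,b,c) = (a',b',c'), and ∫_{(ℂ²)³} | [z₁|z₂⟩^a · [z₁|z₃⟩^b · [z₂|z₃⟩^c |² ∏_{i=1}^3 dμ(z_i) = (a+b+c+1)! · a! · b! · c!. (Equivalently, the trivalent discrete-coherent states |k₁₂,k₁₃,k₂₃⟩ are orthogonal with squared norm equal to the triangle coefficient Δ²(j₁j₂j₃) = (J+1)!/(k₁₂!·k₁₃!·k₂₃!).) -/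
/-!
STATEMENT 18: the trivalent discrete-coherent states are orthogonal with
squared norm (a+b+c+1)!·a!·b!·c! in the Bargmann inner product.
-/

noncomputable section

open MeasureTheory

/-- The trivalent monomial `[z₁|z₂⟩^a·[z₁|z₃⟩^b·[z₂|z₃⟩^c`. -/
def mono (a b c : ℕ) (z : Fin 3 → Spinor) : ℂ :=
  bra (z 0) (z 1) ^ a * bra (z 0) (z 2) ^ b * bra (z 1) (z 2) ^ c

/-- The one-variable Gaussian density. -/
def gaussianDensity (w : ℂ) : ℝ := Real.pi⁻¹ * Real.exp (-Complex.normSq w)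

lemma gdens_eq_prod (z : Spinor) : gdens z = ∏ j, gaussianDensity (z j) := by
  rw [Fin.prod_univ_two, gdens, gaussianDensity, gaussianDensity, neg_add, Real.exp_add]
  ring

lemma gaussianDensity_circle_mul (u : Circle) (w : ℂ) :
    gaussianDensity (u * w) = gaussianDensity w := by
  simp [gaussianDensity]

lemma gaussianDensity_eq (w : ℂ) :
    gaussianDensity w = Real.pi⁻¹ * Real.exp (-‖w‖ ^ (2 : ℝ)) := by
  rw [gaussianDensity, Complex.normSq_eq_norm_sq, Real.rpow_two]

lemma integral_norm_pow_mul_gaussianDensity (n : ℕ) :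
    ∫ w : ℂ, ‖w‖ ^ n * gaussianDensity w = Real.Gamma ((n + 2) / 2) := by
  have h := Complex.integral_rpow_mul_exp_neg_rpow (p := 2) (q := n) (by norm_num)
    (by have : (0 : ℝ) ≤ n := n.cast_nonneg
        linarith)
  simp_rw [Real.rpow_natCast] at h
  simp_rw [gaussianDensity_eq, mul_left_comm _ Real.pi⁻¹, integral_const_mul, h]
  field_simp

lemma integrable_norm_pow_mul_gaussianDensity (n : ℕ) :
    Integrable fun w : ℂ => ‖w‖ ^ n * gaussianDensity w := by
  apply Integrable.of_integral_ne_zero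
  rw [integral_norm_pow_mul_gaussianDensity]
  exact (Real.Gamma_pos_of_pos (by positivity)).ne'

lemma integrable_conj_pow_mul_pow (m n : ℕ) :
    Integrable fun w : ℂ => starRingEnd ℂ w ^ m * w ^ n * gaussianDensity w := by
  refine (integrable_norm_pow_mul_gaussianDensity (m + n)).mono' ?_ (.of_forall fun w => ?_)
  · have : Continuous fun w : ℂ => starRingEnd ℂ w ^ m * w ^ n * gaussianDensity w := by
      unfold gaussianDensity
      have := Complex.continuous_normSq
      have := Complex.continuous_conj
      fun_prop
    exact this.aestronglyMeasurable
  · have : 0 ≤ gaussianDensity w := by unfold gaussianDensity; positivity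
    simp [abs_of_nonneg this, pow_add]

lemma exists_circle_conj_pow_mul_pow_ne_one {m n : ℕ} (h : m ≠ n) :
    ∃ u : Circle, starRingEnd ℂ (u : ℂ) ^ m * (u : ℂ) ^ n ≠ 1 := by
  have hne : (n : ℂ) - m ≠ 0 := sub_ne_zero.2 (by exact_mod_cast h.symm)
  refine ⟨Circle.exp (Real.pi / (n - m)), ?_⟩
  rw [Circle.coe_exp, ← Complex.exp_conj, ← Complex.exp_nat_mul, ← Complex.exp_nat_mul,
    ← Complex.exp_add]
  have : (m : ℂ) * starRingEnd ℂ (((Real.pi / (n - m) : ℝ) : ℂ) * Complex.I)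
      + n * (((Real.pi / (n - m) : ℝ) : ℂ) * Complex.I) = Real.pi * Complex.I := by
    rw [map_mul, Complex.conj_ofReal, Complex.conj_I]
    push_cast
    field_simp
    ring
  rw [this, Complex.exp_pi_mul_I]
  norm_num

lemma measurePreserving_circle_mul (u : Circle) :
    MeasurePreserving (fun w : ℂ => (u : ℂ) * w) :=
  (rotation u).measurePreserving

lemma eq_zero_of_eq_mul_of_ne_one {x c : ℂ} (hc : c ≠ 1) (h : x = c * x) : x = 0 := by
  have : (1 - c) * x = 0 := by linear_combination h
  exact (mul_eq_zero.1 this).resolve_left (sub_ne_zero.2 hc.symm)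

lemma integral_conj_pow_mul_pow (m n : ℕ) :
    ∫ w : ℂ, starRingEnd ℂ w ^ m * w ^ n * gaussianDensity w
      = if m = n then (n.factorial : ℂ) else 0 := by
  split_ifs with h
  · subst h
    have key (w : ℂ) : starRingEnd ℂ w ^ m * w ^ m * gaussianDensity w
        = ((‖w‖ ^ (2 * m) * gaussianDensity w : ℝ) : ℂ) := by
      rw [← mul_pow, mul_comm (starRingEnd ℂ w), Complex.mul_conj, Complex.normSq_eq_norm_sq]
      push_cast
      rw [pow_mul]
    simp_rw [key]
    rw [integral_complex_ofReal, integral_norm_pow_mul_gaussianDensity]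
    have : ((2 * m : ℕ) + 2 : ℝ) / 2 = m + 1 := by
      push_cast
      ring
    rw [this, Real.Gamma_nat_eq_factorial]
    simp
  · obtain ⟨u, hu⟩ := exists_circle_conj_pow_mul_pow_ne_one h
    refine eq_zero_of_eq_mul_of_ne_one hu ?_
    have hemb : MeasurableEmbedding (fun w : ℂ => (u : ℂ) * w) :=
      (rotation u).toHomeomorph.measurableEmbedding
    rw [← integral_const_mul, ← (measurePreserving_circle_mul u).integral_comp hemb]
    congr 1 with w
    rw [gaussianDensity_circle_mul, map_mul]
    ring

open MvPolynomial

/-- The index of the six complex coordinates. -/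
abbrev Coord := Fin 3 × Fin 2

/-- The value of a polynomial at a triple of spinors. -/
def evalSpinors (z : Fin 3 → Spinor) : MvPolynomial Coord ℂ →ₐ[ℂ] ℂ :=
  aeval fun k => z k.1 k.2

/-- The integrand of the Bargmann inner product. -/
def bargmannIntegrand (p q : MvPolynomial Coord ℂ) (z : Fin 3 → Spinor) : ℂ :=
  starRingEnd ℂ (evalSpinors z p) * evalSpinors z q * ∏ i, (gdens (z i) : ℂ)

/-- The Bargmann inner product of polynomials. -/
def bargmann (p q : MvPolynomial Coord ℂ) : ℂ := ∫ z, bargmannIntegrand p q z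

lemma bargmannIntegrand_monomial (s t : Coord →₀ ℕ) (x y : ℂ) (z : Fin 3 → Spinor) :
    bargmannIntegrand (monomial s x) (monomial t y) z = starRingEnd ℂ x * y *
      ∏ i, ∏ j, starRingEnd ℂ (z i j) ^ s (i, j) * z i j ^ t (i, j) * gaussianDensity (z i j) := by
  simp only [bargmannIntegrand, evalSpinors, aeval_monomial, gdens_eq_prod,
    Finsupp.prod_fintype _ _ (fun _ => pow_zero _), Fintype.prod_prod_type,
    Finset.prod_mul_distrib, Complex.ofReal_prod, map_mul, map_prod, map_pow,
    Algebra.algebraMap_self, RingHom.id_apply]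
  ring

lemma integrable_bargmannIntegrand_monomial (s t : Coord →₀ ℕ) (x y : ℂ) :
    Integrable (bargmannIntegrand (monomial s x) (monomial t y)) := by
  simp_rw [funext (bargmannIntegrand_monomial s t x y)]
  refine Integrable.const_mul ?_ _
  refine Integrable.fintype_prod (f := fun i (v : Spinor) =>
    ∏ j, starRingEnd ℂ (v j) ^ s (i, j) * v j ^ t (i, j) * (gaussianDensity (v j) : ℂ)) fun i => ?_
  exact Integrable.fintype_prod (f := fun j (w : ℂ) =>
    starRingEnd ℂ w ^ s (i, j) * w ^ t (i, j) * (gaussianDensity w : ℂ))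
    fun j => integrable_conj_pow_mul_pow _ _

lemma bargmann_monomial (s t : Coord →₀ ℕ) (x y : ℂ) :
    bargmann (monomial s x) (monomial t y)
      = starRingEnd ℂ x * y * ∏ k, if s k = t k then ((t k).factorial : ℂ) else 0 := by
  simp_rw [bargmann, bargmannIntegrand_monomial, integral_const_mul]
  rw [integral_fintype_prod_volume_eq_prod (f := fun i (v : Spinor) =>
    ∏ j, starRingEnd ℂ (v j) ^ s (i, j) * v j ^ t (i, j) * (gaussianDensity (v j) : ℂ)),
    Fintype.prod_prod_type]
  congr 1
  refine Finset.prod_congr rfl fun i _ => ?_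
  rw [integral_fintype_prod_volume_eq_prod (f := fun j (w : ℂ) =>
    starRingEnd ℂ w ^ s (i, j) * w ^ t (i, j) * (gaussianDensity w : ℂ))]
  exact Finset.prod_congr rfl fun j _ => integral_conj_pow_mul_pow _ _

lemma bargmannIntegrand_add_left (p p' q : MvPolynomial Coord ℂ) :
    bargmannIntegrand (p + p') q = bargmannIntegrand p q + bargmannIntegrand p' q := by
  ext z
  simp only [bargmannIntegrand, map_add, Pi.add_apply]
  ring

lemma bargmannIntegrand_add_right (p q q' : MvPolynomial Coord ℂ) :
    bargmannIntegrand p (q + q') = bargmannIntegrand p q + bargmannIntegrand p q' := by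
  ext z
  simp only [bargmannIntegrand, map_add, Pi.add_apply]
  ring

lemma integrable_bargmannIntegrand (p q : MvPolynomial Coord ℂ) :
    Integrable (bargmannIntegrand p q) := by
  induction p using MvPolynomial.induction_on' with
  | monomial s x =>
    induction q using MvPolynomial.induction_on' with
    | monomial t y => exact integrable_bargmannIntegrand_monomial s t x y
    | add q q' hq hq' => exact bargmannIntegrand_add_right _ q q' ▸ hq.add hq'
  | add p p' hp hp' => exact bargmannIntegrand_add_left p p' q ▸ hp.add hp'

lemma bargmann_add_left (p p' q : MvPolynomial Coord ℂ) :
    bargmann (p + p') q = bargmann p q + bargmann p' q := by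
  simp_rw [bargmann, bargmannIntegrand_add_left]
  exact integral_add (integrable_bargmannIntegrand p q) (integrable_bargmannIntegrand p' q)

lemma bargmann_add_right (p q q' : MvPolynomial Coord ℂ) :
    bargmann p (q + q') = bargmann p q + bargmann p q' := by
  simp_rw [bargmann, bargmannIntegrand_add_right]
  exact integral_add (integrable_bargmannIntegrand p q) (integrable_bargmannIntegrand p q')

lemma bargmann_natCast_mul_right (n : ℕ) (p q : MvPolynomial Coord ℂ) :
    bargmann p (n * q) = n * bargmann p q := by
  rw [bargmann, bargmann, ← integral_const_mul]
  congr 1 with z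
  simp only [bargmannIntegrand, map_mul, map_natCast]
  ring

lemma bargmann_sub_left (p p' q : MvPolynomial Coord ℂ) :
    bargmann (p - p') q = bargmann p q - bargmann p' q := by
  rw [eq_sub_iff_add_eq, ← bargmann_add_left, sub_add_cancel]

lemma bargmann_sub_right (p q q' : MvPolynomial Coord ℂ) :
    bargmann p (q - q') = bargmann p q - bargmann p q' := by
  rw [eq_sub_iff_add_eq, ← bargmann_add_right, sub_add_cancel]

/-- Multiplication by a coordinate is adjoint to differentiation. -/
lemma bargmann_X_mul (k : Coord) (p q : MvPolynomial Coord ℂ) :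
    bargmann (X k * p) q = bargmann p (pderiv k q) := by
  induction p using MvPolynomial.induction_on' with
  | monomial s x =>
    induction q using MvPolynomial.induction_on' with
    | monomial t y =>
      rw [pderiv_monomial, X, monomial_mul, bargmann_monomial, bargmann_monomial,
        Fintype.prod_eq_mul_prod_compl k, Fintype.prod_eq_mul_prod_compl k, one_mul]
      have h : ∏ l ∈ {k}ᶜ, (if (Finsupp.single k 1 + s : Coord →₀ ℕ) l = t l
            then ((t l).factorial : ℂ) else 0)
          = ∏ l ∈ {k}ᶜ, if s l = (t - Finsupp.single k 1 : Coord →₀ ℕ) l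
            then (((t - Finsupp.single k 1 : Coord →₀ ℕ) l).factorial : ℂ) else 0 := by
        refine Finset.prod_congr rfl fun l hl => ?_
        have hl : k ≠ l := by simpa [eq_comm] using hl
        simp [Finsupp.single_eq_of_ne' hl]
      rw [h]
      rcases ht : t k with _ | m
      · simp
      · by_cases hs : s k = m
        · simp [ht, hs, add_comm 1, Nat.factorial_succ]
          ring
        · have hs' : 1 + s k ≠ m + 1 := by omega
          simp [ht, hs, hs']
    | add q q' hq hq' => rw [map_add, bargmann_add_right, bargmann_add_right, hq, hq']
  | add p r hp hr => rw [mul_add, bargmann_add_left, bargmann_add_left, hp, hr]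

/-- The bracket of the `i`-th and `j`-th spinors as a polynomial. -/
def braPoly (i j : Fin 3) : MvPolynomial Coord ℂ :=
  X (i, 0) * X (j, 1) - X (i, 1) * X (j, 0)

/-- The Cayley operator adjoint to multiplication by `braPoly i j`. -/
def cayley (i j : Fin 3) (p : MvPolynomial Coord ℂ) : MvPolynomial Coord ℂ :=
  pderiv (j, 1) (pderiv (i, 0) p) - pderiv (j, 0) (pderiv (i, 1) p)

lemma bargmann_braPoly_mul (i j : Fin 3) (p q : MvPolynomial Coord ℂ) :
    bargmann (braPoly i j * p) q = bargmann p (cayley i j q) := by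
  simp_rw [braPoly, cayley, sub_mul, mul_assoc, bargmann_sub_left, bargmann_sub_right,
    bargmann_X_mul]

/-- The trivalent monomial as a polynomial. -/
def monoPoly (a b c : ℕ) : MvPolynomial Coord ℂ :=
  braPoly 0 1 ^ a * braPoly 0 2 ^ b * braPoly 1 2 ^ c

lemma evalSpinors_monoPoly (a b c : ℕ) (z : Fin 3 → Spinor) :
    evalSpinors z (monoPoly a b c) = mono a b c z := by
  simp [evalSpinors, monoPoly, braPoly, mono, bra]

lemma cayley_zero_one_monoPoly (a b c : ℕ) :
    cayley 0 1 (monoPoly (a + 1) b c)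
      = ((a + 1) * (a + b + c + 2) : ℕ) * monoPoly a b c := by
  rcases a with _ | a <;> rcases b with _ | b <;> rcases c with _ | c <;>
  · simp [cayley, monoPoly, braPoly, pderiv_X]
    ring

lemma cayley_zero_two_monoPoly (b c : ℕ) :
    cayley 0 2 (monoPoly 0 (b + 1) c)
      = ((b + 1) * (b + c + 2) : ℕ) * monoPoly 0 b c := by
  rcases b with _ | b <;> rcases c with _ | c <;>
  · simp [cayley, monoPoly, braPoly, pderiv_X]
    ring

lemma cayley_one_two_monoPoly (c : ℕ) :
    cayley 1 2 (monoPoly 0 0 (c + 1)) = ((c + 1) * (c + 2) : ℕ) * monoPoly 0 0 c := by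
  rcases c with _ | c <;>
  · simp [cayley, monoPoly, braPoly, pderiv_X]
    ring

lemma bargmann_monoPoly_self (a b c : ℕ) :
    bargmann (monoPoly a b c) (monoPoly a b c)
      = (a + b + c + 1).factorial * a.factorial * b.factorial * c.factorial := by
  induction a with
  | succ a ih =>
    have h : monoPoly (a + 1) b c = braPoly 0 1 * monoPoly a b c := by
      simp only [monoPoly]
      ring
    conv_lhs => rw [h, bargmann_braPoly_mul, ← h, cayley_zero_one_monoPoly,
      bargmann_natCast_mul_right, ih]
    rw [show a + 1 + b + c + 1 = a + b + c + 1 + 1 by ring, Nat.factorial_succ (a + b + c + 1),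
      Nat.factorial_succ a]
    push_cast
    ring
  | zero =>
    induction b with
    | succ b ih =>
      have h : monoPoly 0 (b + 1) c = braPoly 0 2 * monoPoly 0 b c := by
        simp only [monoPoly]
        ring
      conv_lhs => rw [h, bargmann_braPoly_mul, ← h, cayley_zero_two_monoPoly,
        bargmann_natCast_mul_right, ih]
      rw [show 0 + (b + 1) + c + 1 = 0 + b + c + 1 + 1 by ring,
        Nat.factorial_succ (0 + b + c + 1), Nat.factorial_succ b]
      push_cast
      ring
    | zero =>
      induction c with
      | succ c ih =>
        have h : monoPoly 0 0 (c + 1) = braPoly 1 2 * monoPoly 0 0 c := by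
          simp only [monoPoly]
          ring
        conv_lhs => rw [h, bargmann_braPoly_mul, ← h, cayley_one_two_monoPoly,
          bargmann_natCast_mul_right, ih]
        rw [show 0 + 0 + (c + 1) + 1 = 0 + 0 + c + 1 + 1 by ring,
          Nat.factorial_succ (0 + 0 + c + 1), Nat.factorial_succ c]
        push_cast
        ring
      | zero =>
        have h : monoPoly 0 0 0 = monomial 0 1 := by simp [monoPoly]
        rw [h, bargmann_monomial]
        simp

/-- Multiplication of each spinor of a triple by its own phase. -/
def phaseRotation (u : Fin 3 → Circle) : (Fin 3 → Spinor) ≃ᵐ (Fin 3 → Spinor) :=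
  .piCongrRight fun i => .piCongrRight fun _ => (rotation (u i)).toHomeomorph.toMeasurableEquiv

lemma phaseRotation_apply (u : Fin 3 → Circle) (z : Fin 3 → Spinor) (i : Fin 3) (j : Fin 2) :
    phaseRotation u z i j = u i * z i j := rfl

lemma measurePreserving_phaseRotation (u : Fin 3 → Circle) :
    MeasurePreserving (phaseRotation u) :=
  volume_preserving_pi fun i => volume_preserving_pi fun _ => measurePreserving_circle_mul (u i)

lemma gdens_phaseRotation (u : Fin 3 → Circle) (z : Fin 3 → Spinor) (i : Fin 3) :
    gdens (phaseRotation u z i) = gdens (z i) := by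
  simp_rw [gdens_eq_prod, phaseRotation_apply, gaussianDensity_circle_mul]

lemma mono_phaseRotation (a b c : ℕ) (u : Fin 3 → Circle) (z : Fin 3 → Spinor) :
    mono a b c (phaseRotation u z)
      = (u 0 : ℂ) ^ (a + b) * (u 1 : ℂ) ^ (a + c) * (u 2 : ℂ) ^ (b + c) * mono a b c z := by
  have h (i j : Fin 3) : bra (phaseRotation u z i) (phaseRotation u z j)
      = u i * u j * bra (z i) (z j) := by
    simp only [bra, phaseRotation_apply]
    ring
  simp only [mono, h]
  ring

lemma integral_conj_mono_mul_mono_phase (a b c a' b' c' : ℕ) (u : Fin 3 → Circle) :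
    (∫ z : Fin 3 → Spinor, starRingEnd ℂ (mono a b c z) * mono a' b' c' z
        * ∏ i, (gdens (z i) : ℂ))
      = (starRingEnd ℂ (u 0 : ℂ) ^ (a + b) * (u 0 : ℂ) ^ (a' + b'))
        * (starRingEnd ℂ (u 1 : ℂ) ^ (a + c) * (u 1 : ℂ) ^ (a' + c'))
        * (starRingEnd ℂ (u 2 : ℂ) ^ (b + c) * (u 2 : ℂ) ^ (b' + c'))
        * ∫ z : Fin 3 → Spinor, starRingEnd ℂ (mono a b c z) * mono a' b' c' z
          * ∏ i, (gdens (z i) : ℂ) := by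
  conv_lhs => rw [← (measurePreserving_phaseRotation u).integral_comp']
  rw [← integral_const_mul]
  congr 1 with z
  simp only [mono_phaseRotation, gdens_phaseRotation, map_mul, map_pow]
  ring

lemma integral_conj_mono_mul_mono_of_ne {a b c a' b' c' : ℕ} (h : (a, b, c) ≠ (a', b', c')) :
    (∫ z : Fin 3 → Spinor, starRingEnd ℂ (mono a b c z) * mono a' b' c' z
      * ∏ i, (gdens (z i) : ℂ)) = 0 := by
  have hdeg : a + b ≠ a' + b' ∨ a + c ≠ a' + c' ∨ b + c ≠ b' + c' := by
    simp only [ne_eq, Prod.mk.injEq] at h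
    omega
  have key := integral_conj_mono_mul_mono_phase a b c a' b' c'
  rcases hdeg with hd | hd | hd <;>
    obtain ⟨v, hv⟩ := exists_circle_conj_pow_mul_pow_ne_one hd
  · exact eq_zero_of_eq_mul_of_ne_one hv (by simpa using key ![v, 1, 1])
  · exact eq_zero_of_eq_mul_of_ne_one hv (by simpa using key ![1, v, 1])
  · exact eq_zero_of_eq_mul_of_ne_one hv (by simpa using key ![1, 1, v])

theorem trivalent_orthogonality (a b c a' b' c' : ℕ) :
    ((a, b, c) ≠ (a', b', c') →
      (∫ z : Fin 3 → Spinor,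
          starRingEnd ℂ (mono a b c z) * mono a' b' c' z
            * ∏ i, (gdens (z i) : ℂ)) = 0)
    ∧ (∫ z : Fin 3 → Spinor,
          starRingEnd ℂ (mono a b c z) * mono a b c z
            * ∏ i, (gdens (z i) : ℂ))
        = ((Nat.factorial (a + b + c + 1) : ℂ) * (Nat.factorial a : ℂ)
            * (Nat.factorial b : ℂ) * (Nat.factorial c : ℂ)) := by
  refine ⟨integral_conj_mono_mul_mono_of_ne, ?_⟩
  rw [← bargmann_monoPoly_self]
  simp only [bargmann, bargmannIntegrand, evalSpinors_monoPoly]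
end
end
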